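/- arXiv:2603.08381 — 5 statements merged into one kernel-verified Lean document; each statement's English description precedes it below -/
import Mathlib

section
/- Let m = 2q+1 ≥ 3 be odd and let [(x_i, y_i)]_{i=0}^{3q} be an ordering of the pairs of a strong starter in ℤ/(3m) such that x_0 ≡ y_0 (mod m) and, for each d = 1,…,q, the three pairs with indices 3d−2, 3d−1, 3d satisfy y_i − x_i ≡ ε_d·d (mod m) for a common sign ε_d ∈ {+1,−1}. Set u_i = x_i mod m and v_i = y_i mod m. Let r ≥ 3 and let f : ℤ/(3m) → ℤ/r satisfy f(0) = 0 and be such that Φ(x) = (x mod m, f(x)) is injective. Then Σ = [(u_i,v_i)]_{i=0}^{3q} is a triplication table of order m, and the x_i, y_i satisfy the Sudoku constraints (Row), (Sum), (Color) with respect to f. -/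
/-- The natural reduction map `ℤ/(3m) → ℤ/m` for `m = 2q+1`. -/
def redMod (q : ℕ) : ZMod (3*(2*q+1)) →+* ZMod (2*q+1) :=
  ZMod.castHom (dvd_mul_left (2*q+1) 3) (ZMod (2*q+1))

/-- A strong starter in `ℤ/n`, presented as an indexed family of `k` ordered pairs
`(x i, y i)`, `i = 0, …, k-1`:
(i) the `2k` entries are pairwise distinct and comprise `ℤ/n ∖ {0}`;
(ii) the `2k` differences `±(x i − y i)` are pairwise distinct and comprise `ℤ/n ∖ {0}`;
(iii) the `k` sums `x i + y i` are pairwise distinct and nonzero. -/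
def IsStrongStarterIdx (n k : ℕ) (x y : ℕ → ZMod n) : Prop :=
  (∀ i j, i < k → j < k → (x i = x j → i = j) ∧ (y i = y j → i = j) ∧ x i ≠ y j) ∧
  (∀ z : ZMod n, z ≠ 0 ↔ ∃ i, i < k ∧ (x i = z ∨ y i = z)) ∧
  (∀ i j, i < k → j < k → (x i - y i = x j - y j → i = j) ∧ x i - y i ≠ y j - x j) ∧
  (∀ z : ZMod n, z ≠ 0 ↔ ∃ i, i < k ∧ (x i - y i = z ∨ y i - x i = z)) ∧
  (∀ i j, i < k → j < k → x i + y i = x j + y j → i = j) ∧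
  (∀ i, i < k → x i + y i ≠ 0)

/-- A triplication table of order `m = 2q+1`, presented as an indexed family of `3q+1`
ordered pairs `(u i, v i)`, `i = 0,…,3q`:
(i) among the `6q+2` components, each nonzero element of `ℤ/m` occurs exactly three
times and `0` occurs exactly twice;
(ii) `u 0 = v 0 ≠ 0`, and for each `d = 1,…,q` there is a sign `ε ∈ {1,-1}` with
`v i − u i = ε·d` for `i ∈ {3d−2, 3d−1, 3d}`;
(iii) at most three pairs have any given nonzero sum, at most two pairs have sum `0`;
(iv) the `3q+1` ordered pairs are pairwise distinct. -/
def IsTriplicationTable (q : ℕ) (u v : ℕ → ZMod (2*q+1)) : Prop :=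
  (∀ c : ZMod (2*q+1),
    (((Finset.range (3*q+1)) ×ˢ (Finset.univ : Finset Bool)).filter
      (fun p => (if p.2 then v p.1 else u p.1) = c)).card = if c = 0 then 2 else 3) ∧
  (u 0 = v 0 ∧ u 0 ≠ 0) ∧
  (∀ d, 1 ≤ d → d ≤ q → ∃ ε : ℤ, (ε = 1 ∨ ε = -1) ∧
    v (3*d-2) - u (3*d-2) = (ε : ZMod (2*q+1)) * (d : ZMod (2*q+1)) ∧
    v (3*d-1) - u (3*d-1) = (ε : ZMod (2*q+1)) * (d : ZMod (2*q+1)) ∧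
    v (3*d) - u (3*d) = (ε : ZMod (2*q+1)) * (d : ZMod (2*q+1))) ∧
  (∀ s : ZMod (2*q+1), s ≠ 0 →
    ((Finset.range (3*q+1)).filter (fun i => u i + v i = s)).card ≤ 3) ∧
  (((Finset.range (3*q+1)).filter (fun i => u i + v i = 0)).card ≤ 2) ∧
  (∀ i j, i < 3*q+1 → j < 3*q+1 → u i = u j → v i = v j → i = j)

/-- The Sudoku constraints (Row), (Sum), (Color) for a discriminating function
`f : ℤ/(3m) → ℤ/r` (`m = 2q+1`), a triplication table `(u, v)` of order `m`, and
elements `x i, y i ∈ ℤ/(3m)` aligned with the table: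
(Row) `f (x 0 − y 0) ≠ 0` and in each regular row the three values `f (x i − y i)`
are pairwise distinct;
(Sum) pairs of the table with equal sums in `ℤ/m` have distinct values `f (x i + y i)`,
and pairs with sum `0` in `ℤ/m` have `f (x i + y i) ≠ 0`;
(Color) component positions of the table carrying the same value of `ℤ/m` carry
distinct discriminating values (`f (x i)` for a `u`-component, `f (y i)` for a
`v`-component), and positions carrying `0` carry nonzero discriminating values. -/
def SudokuConstraints (q r : ℕ) (u v : ℕ → ZMod (2*q+1))
    (f : ZMod (3*(2*q+1)) → ZMod r) (x y : ℕ → ZMod (3*(2*q+1))) : Prop :=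
  (f (x 0 - y 0) ≠ 0) ∧
  (∀ d, 1 ≤ d → d ≤ q →
    f (x (3*d-2) - y (3*d-2)) ≠ f (x (3*d-1) - y (3*d-1)) ∧
    f (x (3*d-2) - y (3*d-2)) ≠ f (x (3*d) - y (3*d)) ∧
    f (x (3*d-1) - y (3*d-1)) ≠ f (x (3*d) - y (3*d))) ∧
  (∀ i j, i < 3*q+1 → j < 3*q+1 → i ≠ j → u i + v i = u j + v j →
    f (x i + y i) ≠ f (x j + y j)) ∧
  (∀ i, i < 3*q+1 → u i + v i = 0 → f (x i + y i) ≠ 0) ∧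
  (∀ i j, i < 3*q+1 → j < 3*q+1 → ∀ bi bj : Bool, (i, bi) ≠ (j, bj) →
    (if bi then v i else u i) = (if bj then v j else u j) →
    (if bi then f (y i) else f (x i)) ≠ (if bj then f (y j) else f (x j))) ∧
  (∀ i, i < 3*q+1 → ∀ b : Bool, (if b then v i else u i) = 0 →
    (if b then f (y i) else f (x i)) ≠ 0)

instance neZero_three_mul (q : ℕ) : NeZero (3 * (2 * q + 1)) := ⟨by omega⟩

theorem redMod_surjective (q : ℕ) : Function.Surjective (redMod q) :=
  ZMod.castHom_surjective _

theorem card_redMod_fiber (q : ℕ) (c : ZMod (2 * q + 1)) :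
    (Finset.univ.filter fun z => redMod q z = c).card = 3 := by
  have hfib : ∀ b, (Finset.univ.filter fun z => redMod q z = b).card =
      (Finset.univ.filter fun z => redMod q z = c).card := fun b =>
    AddMonoidHom.card_fiber_eq_of_mem_range (redMod q).toAddMonoidHom
      (redMod_surjective q b) (redMod_surjective q c)
  have hsum := Finset.card_eq_sum_card_fiberwise (f := redMod q) (s := Finset.univ)
    (t := Finset.univ) (fun _ _ => Finset.mem_coe.2 (Finset.mem_univ _))
  simp only [hfib, Finset.sum_const, Finset.card_univ, ZMod.card, smul_eq_mul] at hsum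
  exact Nat.eq_of_mul_eq_mul_left (Nat.succ_pos (2 * q)) (hsum.symm.trans (mul_comm _ _))

theorem card_redMod_fiber_erase_zero (q : ℕ) (c : ZMod (2 * q + 1)) :
    ((Finset.univ.filter fun z => redMod q z = c).erase 0).card = if c = 0 then 2 else 3 := by
  split_ifs with hc
  · rw [Finset.card_erase_of_mem (by simp [hc]), card_redMod_fiber]
  · rw [Finset.erase_eq_of_notMem (by simp [Ne.symm hc]), card_redMod_fiber]

theorem eq_or_eq_neg_of_redMod_eq_zero {q : ℕ} {a b : ZMod (3 * (2 * q + 1))}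
    (ha : redMod q a = 0) (hb : redMod q b = 0) (ha0 : a ≠ 0) (hb0 : b ≠ 0) :
    a = b ∨ a = -b := by
  by_contra! h
  have hab : a + b ≠ 0 := fun h' => h.2 (eq_neg_of_add_eq_zero_left h')
  have hsub : ({0, a, b, a + b} : Finset (ZMod (3 * (2 * q + 1)))) ⊆
      Finset.univ.filter fun z => redMod q z = 0 := by
    intro z hz
    simp only [Finset.mem_insert, Finset.mem_singleton] at hz
    rcases hz with rfl | rfl | rfl | rfl <;> simp [ha, hb]
  have hcard : ({0, a, b, a + b} : Finset (ZMod (3 * (2 * q + 1)))).card = 4 := by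
    rw [Finset.card_insert_of_notMem, Finset.card_insert_of_notMem,
      Finset.card_insert_of_notMem, Finset.card_singleton] <;>
      simp [ha0, hb0, ha0.symm, hb0.symm, h.1, hab.symm]
  have := Finset.card_le_card hsub
  rw [hcard, card_redMod_fiber] at this
  omega

/-- The `2k` entries of a strong starter, indexed by a pair and a side, are pairwise distinct. -/
theorem IsStrongStarterIdx.entry_injective {n k : ℕ} {x y : ℕ → ZMod n}
    (hS : IsStrongStarterIdx n k x y) {i j : ℕ} (hi : i < k) (hj : j < k) {bi bj : Bool}
    (h : (if bi then y i else x i) = if bj then y j else x j) : (i, bi) = (j, bj) := by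
  obtain ⟨hx, hy, hxy⟩ := hS.1 i j hi hj
  have hyx := (hS.1 j i hj hi).2.2
  cases bi <;> cases bj <;> simp only [Bool.false_eq_true, if_true, if_false] at h
  · rw [hx h]
  · exact absurd h hxy
  · exact absurd h.symm hyx
  · rw [hy h]

theorem IsStrongStarterIdx.entry_ne_zero {n k : ℕ} {x y : ℕ → ZMod n}
    (hS : IsStrongStarterIdx n k x y) {i : ℕ} (hi : i < k) (b : Bool) :
    (if b then y i else x i) ≠ 0 :=
  (hS.2.1 _).2 ⟨i, hi, by cases b <;> simp⟩

theorem IsStrongStarterIdx.card_entry_redMod {q : ℕ} {x y : ℕ → ZMod (3 * (2 * q + 1))}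
    (hS : IsStrongStarterIdx (3 * (2 * q + 1)) (3 * q + 1) x y) (c : ZMod (2 * q + 1)) :
    (((Finset.range (3 * q + 1)) ×ˢ (Finset.univ : Finset Bool)).filter
      (fun p => (if p.2 then redMod q (y p.1) else redMod q (x p.1)) = c)).card =
      if c = 0 then 2 else 3 := by
  rw [← card_redMod_fiber_erase_zero]
  refine Finset.card_bij (fun p _ => if p.2 then y p.1 else x p.1) ?_ ?_ ?_
  · rintro ⟨i, b⟩ hp
    simp only [Finset.mem_filter, Finset.mem_product, Finset.mem_range] at hp
    rw [Finset.mem_erase]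
    refine ⟨hS.entry_ne_zero hp.1.1 b, ?_⟩
    rw [Finset.mem_filter, ← hp.2]
    cases b <;> simp
  · rintro ⟨i, bi⟩ hi ⟨j, bj⟩ hj h
    simp only [Finset.mem_filter, Finset.mem_product, Finset.mem_range] at hi hj
    exact hS.entry_injective hi.1.1 hj.1.1 h
  · intro z hz
    simp only [Finset.mem_erase, Finset.mem_filter, Finset.mem_univ, true_and] at hz
    obtain ⟨i, hi, h | h⟩ := (hS.2.1 z).1 hz.1
    · exact ⟨(i, false), by simp [hi, h, hz.2], by simp [h]⟩
    · exact ⟨(i, true), by simp [hi, h, hz.2], by simp [h]⟩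

theorem IsStrongStarterIdx.card_sum_redMod_le {q : ℕ} {x y : ℕ → ZMod (3 * (2 * q + 1))}
    (hS : IsStrongStarterIdx (3 * (2 * q + 1)) (3 * q + 1) x y) (s : ZMod (2 * q + 1)) :
    ((Finset.range (3 * q + 1)).filter
      (fun i => redMod q (x i) + redMod q (y i) = s)).card ≤ if s = 0 then 2 else 3 := by
  rw [← card_redMod_fiber_erase_zero]
  refine Finset.card_le_card_of_injOn (fun i => x i + y i) ?_ ?_
  · intro i hi
    simp only [Finset.coe_filter, Finset.mem_range, Set.mem_ofPred_eq] at hi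
    simpa [hS.2.2.2.2.2 i hi.1] using hi.2
  · intro i hi j hj h
    simp only [Finset.coe_filter, Finset.mem_range, Set.mem_ofPred_eq] at hi hj
    exact hS.2.2.2.2.1 i j hi.1 hj.1 h

theorem IsStrongStarterIdx.redMod_pair_injective {q : ℕ} {x y : ℕ → ZMod (3 * (2 * q + 1))}
    (hS : IsStrongStarterIdx (3 * (2 * q + 1)) (3 * q + 1) x y) {i j : ℕ}
    (hi : i < 3 * q + 1) (hj : j < 3 * q + 1) (hx : redMod q (x i) = redMod q (x j))
    (hy : redMod q (y i) = redMod q (y j)) : i = j := by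
  by_contra hij
  have hx0 : x i - x j ≠ 0 := fun h => hij ((hS.1 i j hi hj).1 (sub_eq_zero.1 h))
  have hy0 : y i - y j ≠ 0 := fun h => hij ((hS.1 i j hi hj).2.1 (sub_eq_zero.1 h))
  rcases eq_or_eq_neg_of_redMod_eq_zero (by rw [map_sub, hx, sub_self])
    (by rw [map_sub, hy, sub_self]) hx0 hy0 with h | h
  · exact hij ((hS.2.2.1 i j hi hj).1 (by linear_combination h))
  · exact hij (hS.2.2.2.2.1 i j hi hj (by linear_combination h))

theorem IsStrongStarterIdx.redMod_ne_zero_of_redMod_eq {q : ℕ}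
    {x y : ℕ → ZMod (3 * (2 * q + 1))}
    (hS : IsStrongStarterIdx (3 * (2 * q + 1)) (3 * q + 1) x y) {i : ℕ} (hi : i < 3 * q + 1)
    (h : redMod q (x i) = redMod q (y i)) : redMod q (x i) ≠ 0 := by
  intro h0
  rcases eq_or_eq_neg_of_redMod_eq_zero h0 (h ▸ h0) (hS.entry_ne_zero hi false)
    (hS.entry_ne_zero hi true) with h' | h'
  · exact (hS.1 i i hi hi).2.2 h'
  · exact hS.2.2.2.2.2 i hi (eq_neg_iff_add_eq_zero.1 h')

/-- analysis direction: if `(x i, y i)` is an ordering of a strong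
starter in `ℤ/(3m)` (`m = 2q+1`) whose special pair has equal mod-`m` reductions and
whose rows `3d−2, 3d−1, 3d` have common mod-`m` directed difference `±d`, then the
mod-`m` reductions form a triplication table of order `m`, and for any discriminating
function `f` (`f 0 = 0`, `Φ` injective) the Sudoku constraints hold. -/
theorem stmt7 (q : ℕ) (hq : 1 ≤ q) (x y : ℕ → ZMod (3*(2*q+1)))
    (hS : IsStrongStarterIdx (3*(2*q+1)) (3*q+1) x y)
    (hord0 : redMod q (x 0) = redMod q (y 0))
    (hord : ∀ d, 1 ≤ d → d ≤ q → ∃ ε : ℤ, (ε = 1 ∨ ε = -1) ∧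
      redMod q (y (3*d-2)) - redMod q (x (3*d-2))
        = (ε : ZMod (2*q+1)) * (d : ZMod (2*q+1)) ∧
      redMod q (y (3*d-1)) - redMod q (x (3*d-1))
        = (ε : ZMod (2*q+1)) * (d : ZMod (2*q+1)) ∧
      redMod q (y (3*d)) - redMod q (x (3*d))
        = (ε : ZMod (2*q+1)) * (d : ZMod (2*q+1)))
    (r : ℕ) (hr : 3 ≤ r) (f : ZMod (3*(2*q+1)) → ZMod r) (hf0 : f 0 = 0)
    (hΦ : Function.Injective fun z : ZMod (3*(2*q+1)) => (redMod q z, f z)) :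
    IsTriplicationTable q (fun i => redMod q (x i)) (fun i => redMod q (y i)) ∧
    SudokuConstraints q r (fun i => redMod q (x i)) (fun i => redMod q (y i)) f x y := by
  have hf : ∀ a b, redMod q a = redMod q b → f a = f b → a = b := fun a b h h' =>
    hΦ (Prod.ext h h')
  have hf_ne : ∀ a, redMod q a = 0 → a ≠ 0 → f a ≠ 0 := fun a h ha h' =>
    ha (hf a 0 (by rw [h, map_zero]) (by rw [h', hf0]))
  have hrow : ∀ i j, i < 3 * q + 1 → j < 3 * q + 1 → i ≠ j →
      redMod q (y i) - redMod q (x i) = redMod q (y j) - redMod q (x j) →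
      f (x i - y i) ≠ f (x j - y j) := fun i j hi hj hij h h' =>
    hij ((hS.2.2.1 i j hi hj).1 (hf _ _ (by
      rw [map_sub, map_sub]; linear_combination -h) h'))
  have h0 : 0 < 3 * q + 1 := Nat.succ_pos _
  refine ⟨⟨hS.card_entry_redMod, ⟨hord0, hS.redMod_ne_zero_of_redMod_eq h0 hord0⟩, hord,
    fun s hs => ?_, ?_, fun i j hi hj hx hy => hS.redMod_pair_injective hi hj hx hy⟩,
    ?_, ?_, ?_, ?_, ?_, ?_⟩
  · simpa [hs] using hS.card_sum_redMod_le s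
  · simpa using hS.card_sum_redMod_le 0
  · exact hf_ne _ (by rw [map_sub, hord0, sub_self])
      (sub_ne_zero.2 (hS.1 0 0 h0 h0).2.2)
  · intro d hd hdq
    obtain ⟨ε, -, h₁, h₂, h₃⟩ := hord d hd hdq
    exact ⟨hrow _ _ (by omega) (by omega) (by omega) (h₁.trans h₂.symm),
      hrow _ _ (by omega) (by omega) (by omega) (h₁.trans h₃.symm),
      hrow _ _ (by omega) (by omega) (by omega) (h₂.trans h₃.symm)⟩
  · intro i j hi hj hij h h'
    exact hij (hS.2.2.2.2.1 i j hi hj (hf _ _ (by simpa only [map_add] using h) h'))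
  · intro i hi h
    exact hf_ne _ (by simpa only [map_add] using h) (hS.2.2.2.2.2 i hi)
  · intro i j hi hj bi bj hne h h'
    refine hne (hS.entry_injective hi hj (hf _ _ ?_ ?_))
    · simpa only [apply_ite (redMod q)] using h
    · simpa only [apply_ite f] using h'
  · intro i hi b h
    rw [← apply_ite f]
    exact hf_ne _ (by simpa only [apply_ite (redMod q)] using h) (hS.entry_ne_zero hi b)
end

section
/- Let m = 2q+1 ≥ 3 be odd with gcd(m,3) = 1, and let Σ = [(u_i,v_i)]_{i=0}^{3q} be a triplication table of order m, with components represented by integers u_i, v_i ∈ {0,…,m−1}. Let U_i, V_i ∈ {0,1,2} (i = 0,…,3q) satisfy: (Row) (U_0 − V_0) mod 3 ≠ 0, and for each d = 1,…,q the three values (U_i − V_i) mod 3, i ∈ {3d−2,3d−1,3d}, are pairwise distinct; (Sum) whenever i ≠ j and u_i+v_i ≡ u_j+v_j (mod m) then U_i+V_i ≢ U_j+V_j (mod 3), and whenever u_i+v_i ≡ 0 (mod m) then U_i+V_i ≢ 0 (mod 3); (Color) whenever two distinct component positions of Σ carry the same integer value c, the corresponding values among the U_i (for a u-component) and V_i (for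 a v-component) are distinct, and when c = 0 they are moreover nonzero. For each i let x_i be the unique integer in {0,…,3m−1} with x_i ≡ u_i (mod m) and x_i ≡ U_i (mod 3), and define y_i similarly from v_i, V_i. Then the 3q+1 unordered pairs {x_i, y_i} (taken modulo 3m) constitute a strong starter in ℤ/(3m). -/
/-- If `2k` entries in a type with `2k + 1` elements are pairwise distinct and avoid `a`, they
comprise everything except `a`. -/
theorem ne_iff_exists_eq_or_eq_of_card {α : Type*} [Fintype α] {k : ℕ}
    (hcard : Fintype.card α = 2 * k + 1) {a : α} {x y : ℕ → α}
    (hinj : ∀ i j, i < k → j < k → (x i = x j → i = j) ∧ (y i = y j → i = j) ∧ x i ≠ y j)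
    (hne : ∀ i, i < k → x i ≠ a ∧ y i ≠ a) (z : α) :
    z ≠ a ↔ ∃ i, i < k ∧ (x i = z ∨ y i = z) := by
  classical
  refine ⟨fun hz => ?_, ?_⟩
  · have hxy : Disjoint ((Finset.range k).image x) ((Finset.range k).image y) := by
      simp only [Finset.disjoint_left, Finset.mem_image, Finset.mem_range]
      rintro _ ⟨i, hi, rfl⟩ ⟨j, hj, hij⟩
      exact (hinj i j hi hj).2.2 hij.symm
    have hx : ((Finset.range k).image x).card = k := by
      rw [Finset.card_image_of_injOn, Finset.card_range]
      intro i hi j hj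
      exact (hinj i j (by simpa using hi) (by simpa using hj)).1
    have hy : ((Finset.range k).image y).card = k := by
      rw [Finset.card_image_of_injOn, Finset.card_range]
      intro i hi j hj
      exact (hinj i j (by simpa using hi) (by simpa using hj)).2.1
    have hsub : (Finset.range k).image x ∪ (Finset.range k).image y ⊆ Finset.univ.erase a := by
      intro w hw
      simp only [Finset.mem_union, Finset.mem_image, Finset.mem_range] at hw
      rcases hw with ⟨i, hi, rfl⟩ | ⟨i, hi, rfl⟩
      · simpa using (hne i hi).1
      · simpa using (hne i hi).2
    have heq := Finset.eq_of_subset_of_card_le hsub (by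
      rw [Finset.card_union_of_disjoint hxy, hx, hy, Finset.card_erase_of_mem (Finset.mem_univ a),
        Finset.card_univ, hcard]
      omega)
    have hmem : z ∈ (Finset.range k).image x ∪ (Finset.range k).image y := by
      rw [heq]; simpa using hz
    simp only [Finset.mem_union, Finset.mem_image, Finset.mem_range] at hmem
    rcases hmem with ⟨i, hi, h⟩ | ⟨i, hi, h⟩
    · exact ⟨i, hi, Or.inl h⟩
    · exact ⟨i, hi, Or.inr h⟩
  · rintro ⟨i, hi, rfl | rfl⟩
    · exact (hne i hi).1
    · exact (hne i hi).2

/-- The rows of a triplication table have signed differences `e d` with `|e d| = d`. -/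
theorem IsTriplicationTable.exists_signed_difference {q : ℕ} {u v : ℕ → ZMod (2*q+1)}
    (h : IsTriplicationTable q u v) :
    ∃ e : ℕ → ℤ, (∀ d, d ≤ q → |e d| = d) ∧
      ∀ i, i < 3*q+1 → v i - u i = (e ((i + 2) / 3) : ZMod (2*q+1)) := by
  obtain ⟨-, ⟨h0, -⟩, hrow, -⟩ := h
  have key : ∀ d : ℕ, ∃ e : ℤ, d ≤ q → |e| = d ∧
      ∀ i, i < 3*q+1 → (i + 2) / 3 = d → v i - u i = (e : ZMod (2*q+1)) := by
    intro d
    rcases Nat.eq_zero_or_pos d with rfl | hd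
    · refine ⟨0, fun _ => ⟨by simp, fun i _ hi => ?_⟩⟩
      obtain rfl : i = 0 := by omega
      simp [h0]
    · by_cases hdq : d ≤ q
      · obtain ⟨ε, hε, h1, h2, h3⟩ := hrow d hd hdq
        refine ⟨ε * d, fun _ => ⟨by rcases hε with rfl | rfl <;> simp, fun i _ hi => ?_⟩⟩
        push_cast
        obtain rfl | rfl | rfl : i = 3*d-2 ∨ i = 3*d-1 ∨ i = 3*d := by omega
        exacts [h1, h2, h3]
      · exact ⟨0, fun h => absurd h hdq⟩
  choose e he using key
  exact ⟨e, fun d hd => (he d hd).1, fun i hi => (he _ (by omega)).2 i hi rfl⟩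

/-- Integers of absolute value at most `q` are determined by their residues modulo `2q + 1`. -/
theorem Int.eq_of_cast_zmod_eq {q : ℕ} {a b : ℤ} (ha : |a| ≤ q) (hb : |b| ≤ q)
    (h : (a : ZMod (2*q+1)) = b) : a = b := by
  rw [ZMod.intCast_eq_intCast_iff_dvd_sub] at h
  rw [abs_le] at ha hb
  have := Int.eq_zero_of_abs_lt_dvd h (by push_cast; rw [abs_lt]; constructor <;> linarith)
  linarith

/-- Mod scenario, `gcd(m,3) = 1`: given a triplication table of order
`m = 2q+1` with integer representatives `u i, v i ∈ {0,…,m−1}`, and discriminators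
`U i, V i ∈ {0,1,2}` satisfying the Row, Sum, and Color constraints modulo `3`, the
integers `x i ∈ {0,…,3m−1}` with `x i ≡ u i (mod m)`, `x i ≡ U i (mod 3)` (and
likewise `y i`), obtained by CRT, form a strong starter in `ℤ/(3m)`. -/
theorem stmt9 (q : ℕ) (hq : 1 ≤ q) (hcop : Nat.Coprime (2*q+1) 3)
    (u v U V x y : ℕ → ℕ)
    (huv : ∀ i, i < 3*q+1 → u i < 2*q+1 ∧ v i < 2*q+1)
    (htt : IsTriplicationTable q (fun i => (u i : ZMod (2*q+1)))
      (fun i => (v i : ZMod (2*q+1))))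
    (hUV : ∀ i, i < 3*q+1 → U i < 3 ∧ V i < 3)
    (row0 : (U 0 : ZMod 3) - (V 0 : ZMod 3) ≠ 0)
    (row : ∀ d, 1 ≤ d → d ≤ q →
      (U (3*d-2) : ZMod 3) - V (3*d-2) ≠ (U (3*d-1) : ZMod 3) - V (3*d-1) ∧
      (U (3*d-2) : ZMod 3) - V (3*d-2) ≠ (U (3*d) : ZMod 3) - V (3*d) ∧
      (U (3*d-1) : ZMod 3) - V (3*d-1) ≠ (U (3*d) : ZMod 3) - V (3*d))
    (sum1 : ∀ i j, i < 3*q+1 → j < 3*q+1 → i ≠ j →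
      u i + v i ≡ u j + v j [MOD 2*q+1] →
      (U i : ZMod 3) + V i ≠ (U j : ZMod 3) + V j)
    (sum0 : ∀ i, i < 3*q+1 → u i + v i ≡ 0 [MOD 2*q+1] →
      (U i : ZMod 3) + V i ≠ 0)
    (color : ∀ i j, i < 3*q+1 → j < 3*q+1 → ∀ bi bj : Bool, (i, bi) ≠ (j, bj) →
      (if bi then v i else u i) = (if bj then v j else u j) →
      (if bi then V i else U i) ≠ (if bj then V j else U j))
    (color0 : ∀ i, i < 3*q+1 → ∀ b : Bool,
      (if b then v i else u i) = 0 → (if b then V i else U i) ≠ 0)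
    (hx : ∀ i, i < 3*q+1 →
      x i < 3*(2*q+1) ∧ x i ≡ u i [MOD 2*q+1] ∧ x i ≡ U i [MOD 3])
    (hy : ∀ i, i < 3*q+1 →
      y i < 3*(2*q+1) ∧ y i ≡ v i [MOD 2*q+1] ∧ y i ≡ V i [MOD 3]) :
    IsStrongStarterIdx (3*(2*q+1)) (3*q+1)
      (fun i => (x i : ZMod (3*(2*q+1)))) (fun i => (y i : ZMod (3*(2*q+1)))) := by
  let φ := redMod q
  let ψ := ZMod.castHom (dvd_mul_right 3 (2*q+1)) (ZMod 3)
  have hxm : ∀ i, i < 3*q+1 → (x i : ZMod (2*q+1)) = u i := fun i hi =>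
    (ZMod.natCast_eq_natCast_iff _ _ _).2 (hx i hi).2.1
  have hx3 : ∀ i, i < 3*q+1 → (x i : ZMod 3) = U i := fun i hi =>
    (ZMod.natCast_eq_natCast_iff _ _ _).2 (hx i hi).2.2
  have hym : ∀ i, i < 3*q+1 → (y i : ZMod (2*q+1)) = v i := fun i hi =>
    (ZMod.natCast_eq_natCast_iff _ _ _).2 (hy i hi).2.1
  have hy3 : ∀ i, i < 3*q+1 → (y i : ZMod 3) = V i := fun i hi =>
    (ZMod.natCast_eq_natCast_iff _ _ _).2 (hy i hi).2.2
  have cast_inj {n a b : ℕ} (ha : a < n) (hb : b < n) (h : (a : ZMod n) = b) : a = b :=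
    Nat.ModEq.eq_of_lt_of_lt ((ZMod.natCast_eq_natCast_iff _ _ _).1 h) ha hb
  -- the entry at a component position, and its residues
  have entry : ∀ i j, i < 3*q+1 → j < 3*q+1 → ∀ bi bj : Bool,
      (((if bi then y i else x i : ℕ) : ZMod (3*(2*q+1))) = (if bj then y j else x j : ℕ)) →
      (i, bi) = (j, bj) := by
    intro i j hi hj bi bj h
    by_contra hne
    have h1 := congrArg φ h
    have h2 := congrArg ψ h
    simp only [map_natCast] at h1 h2
    refine color i j hi hj bi bj hne (cast_inj (n := 2*q+1) ?_ ?_ ?_) (cast_inj (n := 3) ?_ ?_ ?_)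
    · have := huv i hi; split_ifs <;> omega
    · have := huv j hj; split_ifs <;> omega
    · cases bi <;> cases bj <;> simpa [hxm, hym, hi, hj] using h1
    · have := hUV i hi; split_ifs <;> omega
    · have := hUV j hj; split_ifs <;> omega
    · cases bi <;> cases bj <;> simpa [hx3, hy3, hi, hj] using h2
  have entry_ne : ∀ i, i < 3*q+1 → ∀ b : Bool,
      ((if b then y i else x i : ℕ) : ZMod (3*(2*q+1))) ≠ 0 := by
    intro i hi b h
    have h1 := congrArg φ h
    have h2 := congrArg ψ h
    simp only [map_natCast, map_zero] at h1 h2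
    refine color0 i hi b (cast_inj (n := 2*q+1) ?_ (by omega) ?_)
      (cast_inj (n := 3) ?_ (by omega) ?_)
    · have := huv i hi; split_ifs <;> omega
    · cases b <;> simpa [hxm, hym, hi] using h1
    · have := hUV i hi; split_ifs <;> omega
    · cases b <;> simpa [hx3, hy3, hi] using h2
  obtain ⟨e, he, hdiff⟩ := htt.exists_signed_difference
  have hrow_le : ∀ i, i < 3*q+1 → |e ((i + 2) / 3)| ≤ q := fun i hi => by
    rw [he _ (by omega)]; exact_mod_cast (by omega : (i + 2) / 3 ≤ q)
  have hrow_eq : ∀ i j, i < 3*q+1 → j < 3*q+1 → |e ((i + 2) / 3)| = |e ((j + 2) / 3)| →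
      (i + 2) / 3 = (j + 2) / 3 := fun i j hi hj h => by
    rw [he _ (by omega), he _ (by omega)] at h
    exact_mod_cast h
  have diff_inj : ∀ i j, i < 3*q+1 → j < 3*q+1 →
      (x i : ZMod (3*(2*q+1))) - y i = x j - y j → i = j := by
    intro i j hi hj h
    have h1 := congrArg φ h
    have h2 := congrArg ψ h
    simp only [map_sub, map_natCast, hxm, hym, hx3, hy3, hi, hj] at h1 h2
    have h3 : (e ((i + 2) / 3) : ZMod (2*q+1)) = e ((j + 2) / 3) := by
      rw [← hdiff i hi, ← hdiff j hj]; linear_combination -h1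
    have hd := hrow_eq i j hi hj
      (congrArg _ (Int.eq_of_cast_zmod_eq (hrow_le i hi) (hrow_le j hj) h3))
    by_cases hi0 : i = 0
    · omega
    obtain ⟨r1, r2, r3⟩ := row ((i + 2) / 3) (by omega) (by omega)
    generalize hdd : (i + 2) / 3 = d at *
    have hi' : i = 3*d-2 ∨ i = 3*d-1 ∨ i = 3*d := by omega
    have hj' : j = 3*d-2 ∨ j = 3*d-1 ∨ j = 3*d := by omega
    rcases hi' with rfl | rfl | rfl <;> rcases hj' with rfl | rfl | rfl
    exacts [rfl, absurd h2 r1, absurd h2 r2, absurd h2.symm r1, rfl, absurd h2 r3,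
      absurd h2.symm r2, absurd h2.symm r3, rfl]
  have diff_ne_neg : ∀ i j, i < 3*q+1 → j < 3*q+1 →
      (x i : ZMod (3*(2*q+1))) - y i ≠ y j - x j := by
    intro i j hi hj h
    have h1 := congrArg φ h
    have h2 := congrArg ψ h
    simp only [map_sub, map_natCast, hxm, hym, hx3, hy3, hi, hj] at h1 h2
    have h3 : (e ((i + 2) / 3) : ZMod (2*q+1)) = (-e ((j + 2) / 3) : ℤ) := by
      push_cast
      rw [← hdiff i hi, ← hdiff j hj]; linear_combination -h1
    have h4 := Int.eq_of_cast_zmod_eq (hrow_le i hi) (by rw [abs_neg]; exact hrow_le j hj) h3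
    have hd := hrow_eq i j hi hj (by rw [h4, abs_neg])
    have h5 := he ((i + 2) / 3) (by omega)
    rw [← hd] at h4
    rw [show e ((i + 2) / 3) = 0 by omega, abs_zero] at h5
    obtain rfl : i = 0 := by omega
    obtain rfl : j = 0 := by omega
    generalize (U 0 : ZMod 3) = a at *
    generalize (V 0 : ZMod 3) = b at *
    revert a b
    decide
  have hinj : ∀ i j, i < 3*q+1 → j < 3*q+1 →
      ((x i : ZMod (3*(2*q+1))) = x j → i = j) ∧ ((y i : ZMod (3*(2*q+1))) = y j → i = j) ∧
        (x i : ZMod (3*(2*q+1))) ≠ y j := fun i j hi hj =>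
    ⟨fun h => congrArg Prod.fst (entry i j hi hj false false h),
      fun h => congrArg Prod.fst (entry i j hi hj true true h),
      fun h => Bool.false_ne_true (congrArg Prod.snd (entry i j hi hj false true h))⟩
  have hcard : Fintype.card (ZMod (3*(2*q+1))) = 2 * (3*q+1) + 1 := by
    rw [ZMod.card]; ring
  have diff_ne : ∀ i, i < 3*q+1 → (x i : ZMod (3*(2*q+1))) - y i ≠ 0 := fun i hi h =>
    (hinj i i hi hi).2.2 (sub_eq_zero.1 h)
  refine ⟨hinj, ne_iff_exists_eq_or_eq_of_card hcard hinj
      fun i hi => ⟨entry_ne i hi false, entry_ne i hi true⟩,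
    fun i j hi hj => ⟨diff_inj i j hi hj, diff_ne_neg i j hi hj⟩,
    ne_iff_exists_eq_or_eq_of_card hcard
      (x := fun i => (x i : ZMod (3*(2*q+1))) - y i)
      (y := fun i => (y i : ZMod (3*(2*q+1))) - x i)
      (fun i j hi hj => ⟨diff_inj i j hi hj, fun h => diff_inj i j hi hj ?_,
        diff_ne_neg i j hi hj⟩)
      fun i hi => ⟨diff_ne i hi, fun h => diff_ne i hi ?_⟩, ?_, ?_⟩
  · linear_combination -h
  · linear_combination -h
  · intro i j hi hj h
    by_contra hne
    have h1 := congrArg φ h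
    have h2 := congrArg ψ h
    simp only [map_add, map_natCast, hxm, hym, hx3, hy3, hi, hj] at h1 h2
    exact sum1 i j hi hj hne ((ZMod.natCast_eq_natCast_iff _ _ _).1 (by exact_mod_cast h1)) h2
  · intro i hi h
    have h1 := congrArg φ h
    have h2 := congrArg ψ h
    simp only [map_add, map_natCast, map_zero, hxm, hym, hx3, hy3, hi] at h1 h2
    exact sum0 i hi ((ZMod.natCast_eq_natCast_iff _ _ _).1 (by exact_mod_cast h1)) h2
end

section
/- Let m = 2q+1 ≥ 3 be odd (no coprimality with 3 assumed) and let Σ = [(u_i,v_i)]_{i=0}^{3q} be a triplication table of order m, with components represented by integers u_i, v_i ∈ {0,…,m−1}. For each i define the difference carry δ_i = 0 if u_i ≥ v_i and δ_i = 1 if u_i < v_i, and the summation carry σ_i = 0 if u_i+v_i < m and σ_i = 1 if u_i+v_i ≥ m. Let U_i, V_i ∈ {0,1,2} satisfy: (Row) (U_0 − V_0 − δ_0) mod 3 ≠ 0, and for each d = 1,…,q the three values (U_i − V_i − δ_i) mod 3, i ∈ {3d−2,3d−1,3d}, are pairwise distinct; (Sum) whenever i ≠ j and u_i+v_i ≡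 u_j+v_j (mod m) then (U_i+V_i+σ_i) ≢ (U_j+V_j+σ_j) (mod 3), and whenever u_i+v_i ≡ 0 (mod m) then (U_i+V_i+σ_i) ≢ 0 (mod 3); (Color) whenever two distinct component positions of Σ carry the same integer value c, the corresponding values among the U_i (for a u-component) and V_i (for a v-component) are distinct, and when c = 0 they are moreover nonzero. Define x_i = (m·U_i + u_i) mod 3m and y_i = (m·V_i + v_i) mod 3m. Then the 3q+1 unordered pairs {x_i, y_i} constitute a strong starter in ℤ/(3m). -/
open Finset in
/-- If `f` and `g` together take `2 * k` distinct nonzero values in `ZMod (2 * k + 1)`, they take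
every nonzero value. -/
lemma ZMod.ne_zero_iff_exists_of_injective {n k : ℕ} (hn : 2 * k + 1 = n) (f g : ℕ → ZMod n)
    (hinj : ∀ i j, i < k → j < k → (f i = f j → i = j) ∧ (g i = g j → i = j) ∧ f i ≠ g j)
    (h0 : ∀ i, i < k → f i ≠ 0 ∧ g i ≠ 0) (z : ZMod n) :
    z ≠ 0 ↔ ∃ i, i < k ∧ (f i = z ∨ g i = z) := by
  have : NeZero n := ⟨by omega⟩
  have hcard : ((range k).image f ∪ (range k).image g).card = 2 * k := by
    rw [card_union_of_disjoint, card_image_of_injOn, card_image_of_injOn, card_range, two_mul]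
    · intro i hi j hj h
      exact (hinj i j (by simpa using hi) (by simpa using hj)).2.1 h
    · intro i hi j hj h
      exact (hinj i j (by simpa using hi) (by simpa using hj)).1 h
    · rw [disjoint_left]
      intro a ha hb
      obtain ⟨i, hi, rfl⟩ := mem_image.1 ha
      obtain ⟨j, hj, h⟩ := mem_image.1 hb
      exact (hinj i j (by simpa using hi) (by simpa using hj)).2.2 h.symm
  have heq : (range k).image f ∪ (range k).image g = univ.erase 0 := by
    refine eq_of_subset_of_card_le (fun a ha => ?_) ?_
    · simp only [mem_union, mem_image, mem_range] at ha
      rw [mem_erase]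
      rcases ha with ⟨i, hi, rfl⟩ | ⟨i, hi, rfl⟩
      · exact ⟨(h0 i hi).1, mem_univ _⟩
      · exact ⟨(h0 i hi).2, mem_univ _⟩
    · rw [hcard, card_erase_of_mem (mem_univ _), card_univ, ZMod.card]
      omega
  have hz : z ∈ (range k).image f ∪ (range k).image g ↔ z ≠ 0 := by simp [heq]
  rw [← hz]
  simp only [mem_union, mem_image, mem_range]
  grind

/-- Uniqueness of the base-`m` digits of a residue modulo `3 * m`. -/
lemma ZMod.digits_eq_of_intCast_eq {m : ℕ} {A B r s : ℤ} (hr : 0 ≤ r) (hr' : r < m)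
    (hs : 0 ≤ s) (hs' : s < m)
    (h : ((m * A + r : ℤ) : ZMod (3 * m)) = ((m * B + s : ℤ) : ZMod (3 * m))) :
    r = s ∧ (A : ZMod 3) = (B : ZMod 3) := by
  rw [ZMod.intCast_eq_intCast_iff_dvd_sub] at h
  obtain ⟨c, hc⟩ := h
  push_cast at hc
  have hrs : r = s := by
    have hdvd : (m : ℤ) ∣ s - r := ⟨3 * c - B + A, by linear_combination hc⟩
    have := Int.eq_zero_of_abs_lt_dvd hdvd (by rw [abs_lt]; constructor <;> linarith)
    linarith
  refine ⟨hrs, ?_⟩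
  subst hrs
  rw [ZMod.intCast_eq_intCast_iff_dvd_sub]
  refine ⟨c, mul_left_cancel₀ (a := (m : ℤ)) (by omega) ?_⟩
  push_cast
  linear_combination hc

/-- The digits of a difference, with borrow. -/
lemma ZMod.digits_sub_eq {m A B C D a b c d : ℕ} (ha : a < m) (hb : b < m) (hc : c < m)
    (hd : d < m)
    (h : ((m * A + a : ℕ) : ZMod (3 * m)) - (m * B + b : ℕ) =
      ((m * C + c : ℕ) : ZMod (3 * m)) - (m * D + d : ℕ)) :
    (a : ZMod m) - b = (c : ZMod m) - d ∧
      (A : ZMod 3) - B - (if a < b then 1 else 0) = (C : ZMod 3) - D - (if c < d then 1 else 0) := by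
  have key := ZMod.digits_eq_of_intCast_eq (m := m)
    (A := (A : ℤ) - B - (if a < b then 1 else 0)) (B := (C : ℤ) - D - (if c < d then 1 else 0))
    (r := (a : ℤ) - b + (if a < b then m else 0)) (s := (c : ℤ) - d + (if c < d then m else 0))
    (by split_ifs <;> omega) (by split_ifs <;> omega) (by split_ifs <;> omega)
    (by split_ifs <;> omega) (by
      rw [show (m : ℤ) * ((A : ℤ) - B - (if a < b then 1 else 0)) +
          ((a : ℤ) - b + (if a < b then m else 0)) = (m * A + a) - (m * B + b) by
            split_ifs <;> ring,
        show (m : ℤ) * ((C : ℤ) - D - (if c < d then 1 else 0)) +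
          ((c : ℤ) - d + (if c < d then m else 0)) = (m * C + c) - (m * D + d) by
            split_ifs <;> ring]
      push_cast at h ⊢
      exact h)
  obtain ⟨h₁, h₂⟩ := key
  constructor
  · have := congrArg (Int.cast : ℤ → ZMod m) h₁
    split_ifs at this <;> simpa using this
  · split_ifs at h₂ ⊢ <;> simpa using h₂

/-- The digits of a sum, with carry. -/
lemma ZMod.digits_add_eq {m A B C D a b c d : ℕ} (ha : a < m) (hb : b < m) (hc : c < m)
    (hd : d < m)
    (h : ((m * A + a : ℕ) : ZMod (3 * m)) + (m * B + b : ℕ) =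
      ((m * C + c : ℕ) : ZMod (3 * m)) + (m * D + d : ℕ)) :
    a + b ≡ c + d [MOD m] ∧
      (A : ZMod 3) + B + (if a + b < m then 0 else 1) =
        (C : ZMod 3) + D + (if c + d < m then 0 else 1) := by
  have key := ZMod.digits_eq_of_intCast_eq (m := m)
    (A := (A : ℤ) + B + (if a + b < m then 0 else 1))
    (B := (C : ℤ) + D + (if c + d < m then 0 else 1))
    (r := (a : ℤ) + b - (if a + b < m then 0 else m))
    (s := (c : ℤ) + d - (if c + d < m then 0 else m))
    (by split_ifs <;> omega) (by split_ifs <;> omega) (by split_ifs <;> omega)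
    (by split_ifs <;> omega) (by
      rw [show (m : ℤ) * ((A : ℤ) + B + (if a + b < m then 0 else 1)) +
          ((a : ℤ) + b - (if a + b < m then 0 else m)) = (m * A + a) + (m * B + b) by
            split_ifs <;> ring,
        show (m : ℤ) * ((C : ℤ) + D + (if c + d < m then 0 else 1)) +
          ((c : ℤ) + d - (if c + d < m then 0 else m)) = (m * C + c) + (m * D + d) by
            split_ifs <;> ring]
      push_cast at h ⊢
      exact h)
  obtain ⟨h₁, h₂⟩ := key
  constructor
  · rw [← ZMod.natCast_eq_natCast_iff]
    have := congrArg (Int.cast : ℤ → ZMod m) h₁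
    split_ifs at this <;> simpa using this
  · split_ifs at h₂ ⊢ <;> simpa using h₂

/-- Equality of two residues modulo `3 * m` determines both digits. -/
lemma ZMod.digits_eq_of_natCast_eq {m A B a b : ℕ} (ha : a < m) (hb : b < m) (hA : A < 3)
    (hB : B < 3) (h : ((m * A + a : ℕ) : ZMod (3 * m)) = (m * B + b : ℕ)) : a = b ∧ A = B := by
  have key := ZMod.digits_eq_of_intCast_eq (m := m) (A := A) (B := B) (r := a) (s := b)
    (by omega) (by omega) (by omega) (by omega) (by push_cast at h ⊢; exact h)
  refine ⟨by exact_mod_cast key.1, ?_⟩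
  have h₂ : ((A : ℕ) : ZMod 3) = (B : ℕ) := by simpa using key.2
  rw [ZMod.natCast_eq_natCast_iff'] at h₂
  omega

/-- Residues `±d, ±e` modulo `2 * q + 1` with `d, e ≤ q` agree only if `d = e`. -/
lemma ZMod.eq_of_sign_mul_eq {q d e : ℕ} (hd : d ≤ q) (he : e ≤ q) {ε η : ℤ}
    (hε : ε = 1 ∨ ε = -1) (hη : η = 1 ∨ η = -1)
    (h : (ε : ZMod (2 * q + 1)) * d = (η : ZMod (2 * q + 1)) * e) : d = e := by
  have h' : ((ε * d : ℤ) : ZMod (2 * q + 1)) = ((η * e : ℤ) : ZMod (2 * q + 1)) := by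
    push_cast; exact h
  rw [ZMod.intCast_eq_intCast_iff_dvd_sub] at h'
  have hz : η * e - ε * d = 0 := by
    refine Int.eq_zero_of_abs_lt_dvd h' ?_
    rw [abs_lt]
    push_cast
    rcases hε with rfl | rfl <;> rcases hη with rfl | rfl <;> constructor <;> omega
  rcases hε with rfl | rfl <;> rcases hη with rfl | rfl <;> omega

lemma ZMod.eq_zero_of_eq_neg {k : ℕ} {z : ZMod (2 * k + 1)} (h : z = -z) : z = 0 :=
  (ZMod.neg_eq_self_iff z).1 h.symm |>.resolve_right (by omega)

namespace IsTriplicationTable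

variable {q : ℕ} {u v : ℕ → ZMod (2 * q + 1)}

/-- The differences of the pairs in row `d` are all `d`, or all `-d`; the pair `0` forms row `0`. -/
lemma exists_sub_eq (h : IsTriplicationTable q u v) {d : ℕ} (hd : d ≤ q) :
    ∃ ε : ℤ, (ε = 1 ∨ ε = -1) ∧
      ∀ i, (i + 2) / 3 = d → v i - u i = (ε : ZMod (2 * q + 1)) * d := by
  rcases Nat.eq_zero_or_pos d with rfl | hd0
  · refine ⟨1, Or.inl rfl, fun i hi => ?_⟩
    rw [show i = 0 by omega, h.2.1.1]
    simp
  · obtain ⟨ε, hε, h₁, h₂, h₃⟩ := h.2.2.1 d hd0 hd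
    refine ⟨ε, hε, fun i hi => ?_⟩
    obtain rfl | rfl | rfl : i = 3 * d - 2 ∨ i = 3 * d - 1 ∨ i = 3 * d := by omega
    · exact h₁
    · exact h₂
    · exact h₃

lemma row_eq_of_sub_eq (h : IsTriplicationTable q u v) {i j : ℕ} (hi : i < 3 * q + 1)
    (hj : j < 3 * q + 1) (hij : u i - v i = u j - v j ∨ u i - v i = v j - u j) :
    (i + 2) / 3 = (j + 2) / 3 := by
  have hdi : (i + 2) / 3 ≤ q := by omega
  have hdj : (j + 2) / 3 ≤ q := by omega
  obtain ⟨ε, hε, h₁⟩ := h.exists_sub_eq hdi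
  obtain ⟨η, hη, h₂⟩ := h.exists_sub_eq hdj
  specialize h₁ i rfl
  specialize h₂ j rfl
  rcases hij with hij | hij
  · exact ZMod.eq_of_sign_mul_eq hdi hdj hε hη (by linear_combination h₂ - h₁ - hij)
  · refine ZMod.eq_of_sign_mul_eq (η := -η) hdi hdj hε (by omega) ?_
    push_cast
    linear_combination -h₂ - h₁ - hij

lemma sub_eq_of_row_eq (h : IsTriplicationTable q u v) {i j : ℕ} (hi : i < 3 * q + 1)
    (hij : (i + 2) / 3 = (j + 2) / 3) : u i - v i = u j - v j := by
  obtain ⟨ε, -, hε⟩ := h.exists_sub_eq (d := (i + 2) / 3) (by omega)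
  linear_combination hε j hij.symm - hε i rfl

lemma eq_zero_of_sub_eq_neg (h : IsTriplicationTable q u v) {i j : ℕ} (hi : i < 3 * q + 1)
    (hj : j < 3 * q + 1) (hij : u i - v i = v j - u j) : i = 0 ∧ j = 0 := by
  have hrow := h.row_eq_of_sub_eq hi hj (Or.inr hij)
  have hsub := h.sub_eq_of_row_eq hi hrow
  have hz : u j - v j = 0 := ZMod.eq_zero_of_eq_neg (by linear_combination hij - hsub)
  have hj0 := h.row_eq_of_sub_eq hj (show 0 < 3 * q + 1 by omega)
    (Or.inl (by rw [hz, h.2.1.1, sub_self]))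
  omega

end IsTriplicationTable

/-- Carry scenario, any odd `m = 2q+1 ≥ 3`: given a triplication table
of order `m` with integer representatives `u i, v i ∈ {0,…,m−1}`, difference carries
`δ i = if u i < v i then 1 else 0`, summation carries
`σ i = if u i + v i < m then 0 else 1`, and discriminators `U i, V i ∈ {0,1,2}`
satisfying the carry-corrected Row, Sum, and Color constraints modulo `3`, the
elements `x i = m·U i + u i` and `y i = m·V i + v i` of `ℤ/(3m)` form a strong
starter in `ℤ/(3m)`. -/
theorem stmt11 (q : ℕ) (hq : 1 ≤ q)
    (u v U V : ℕ → ℕ)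
    (huv : ∀ i, i < 3*q+1 → u i < 2*q+1 ∧ v i < 2*q+1)
    (htt : IsTriplicationTable q (fun i => (u i : ZMod (2*q+1)))
      (fun i => (v i : ZMod (2*q+1))))
    (hUV : ∀ i, i < 3*q+1 → U i < 3 ∧ V i < 3)
    (row0 : (U 0 : ZMod 3) - (V 0 : ZMod 3) - (if u 0 < v 0 then 1 else 0) ≠ 0)
    (row : ∀ d, 1 ≤ d → d ≤ q →
      (U (3*d-2) : ZMod 3) - V (3*d-2) - (if u (3*d-2) < v (3*d-2) then 1 else 0)
        ≠ (U (3*d-1) : ZMod 3) - V (3*d-1) - (if u (3*d-1) < v (3*d-1) then 1 else 0) ∧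
      (U (3*d-2) : ZMod 3) - V (3*d-2) - (if u (3*d-2) < v (3*d-2) then 1 else 0)
        ≠ (U (3*d) : ZMod 3) - V (3*d) - (if u (3*d) < v (3*d) then 1 else 0) ∧
      (U (3*d-1) : ZMod 3) - V (3*d-1) - (if u (3*d-1) < v (3*d-1) then 1 else 0)
        ≠ (U (3*d) : ZMod 3) - V (3*d) - (if u (3*d) < v (3*d) then 1 else 0))
    (sum1 : ∀ i j, i < 3*q+1 → j < 3*q+1 → i ≠ j →
      u i + v i ≡ u j + v j [MOD 2*q+1] →
      (U i : ZMod 3) + V i + (if u i + v i < 2*q+1 then 0 else 1)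
        ≠ (U j : ZMod 3) + V j + (if u j + v j < 2*q+1 then 0 else 1))
    (sum0 : ∀ i, i < 3*q+1 → u i + v i ≡ 0 [MOD 2*q+1] →
      (U i : ZMod 3) + V i + (if u i + v i < 2*q+1 then 0 else 1) ≠ 0)
    (color : ∀ i j, i < 3*q+1 → j < 3*q+1 → ∀ bi bj : Bool, (i, bi) ≠ (j, bj) →
      (if bi then v i else u i) = (if bj then v j else u j) →
      (if bi then V i else U i) ≠ (if bj then V j else U j))
    (color0 : ∀ i, i < 3*q+1 → ∀ b : Bool,
      (if b then v i else u i) = 0 → (if b then V i else U i) ≠ 0) :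
    IsStrongStarterIdx (3*(2*q+1)) (3*q+1)
      (fun i => (((2*q+1) * U i + u i : ℕ) : ZMod (3*(2*q+1))))
      (fun i => (((2*q+1) * V i + v i : ℕ) : ZMod (3*(2*q+1)))) := by
  have entry_inj : ∀ i j, i < 3*q+1 → j < 3*q+1 → ∀ bi bj : Bool,
      (((2*q+1) * (if bi then V i else U i) + (if bi then v i else u i) : ℕ) :
        ZMod (3*(2*q+1))) =
      (((2*q+1) * (if bj then V j else U j) + (if bj then v j else u j) : ℕ) :
        ZMod (3*(2*q+1))) → (i, bi) = (j, bj) := by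
    intro i j hi hj bi bj h
    by_contra hne
    have hui := huv i hi
    have huj := huv j hj
    have hUi := hUV i hi
    have hUj := hUV j hj
    obtain ⟨h₁, h₂⟩ := ZMod.digits_eq_of_natCast_eq (by split_ifs <;> omega)
      (by split_ifs <;> omega) (by split_ifs <;> omega) (by split_ifs <;> omega) h
    exact color i j hi hj bi bj hne h₁ h₂
  have entry_ne : ∀ i, i < 3*q+1 → ∀ b : Bool,
      (((2*q+1) * (if b then V i else U i) + (if b then v i else u i) : ℕ) :
        ZMod (3*(2*q+1))) ≠ 0 := by
    intro i hi b h
    have hui := huv i hi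
    have hUi := hUV i hi
    obtain ⟨h₁, h₂⟩ := ZMod.digits_eq_of_natCast_eq (m := 2*q+1)
      (A := if b then V i else U i) (a := if b then v i else u i) (B := 0) (b := 0)
      (by split_ifs <;> omega) (by omega) (by split_ifs <;> omega) (by omega)
      (by rw [h]; simp)
    exact color0 i hi b h₁ h₂
  set x : ℕ → ZMod (3*(2*q+1)) := fun i => (((2*q+1) * U i + u i : ℕ) : ZMod (3*(2*q+1)))
    with hx
  set y : ℕ → ZMod (3*(2*q+1)) := fun i => (((2*q+1) * V i + v i : ℕ) : ZMod (3*(2*q+1)))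
    with hy
  have entries : ∀ i j, i < 3*q+1 → j < 3*q+1 →
      (x i = x j → i = j) ∧ (y i = y j → i = j) ∧ x i ≠ y j := by
    intro i j hi hj
    refine ⟨fun h => ?_, fun h => ?_, fun h => ?_⟩
    · simpa using entry_inj i j hi hj false false (by simpa [hx] using h)
    · simpa using entry_inj i j hi hj true true (by simpa [hy] using h)
    · simpa using entry_inj i j hi hj false true (by simpa [hx, hy] using h)
  have diffs : ∀ i j, i < 3*q+1 → j < 3*q+1 →
      (x i - y i = x j - y j → i = j) ∧ x i - y i ≠ y j - x j := by
    intro i j hi hj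
    constructor
    · intro h
      obtain ⟨h₁, h₂⟩ := ZMod.digits_sub_eq (huv i hi).1 (huv i hi).2 (huv j hj).1 (huv j hj).2 h
      have hrow := htt.row_eq_of_sub_eq hi hj (Or.inl h₁)
      obtain ⟨d, hd⟩ : ∃ d, (i + 2) / 3 = d := ⟨_, rfl⟩
      rcases Nat.eq_zero_or_pos d with hd0 | hd0
      · omega
      · obtain ⟨r₁, r₂, r₃⟩ := row d hd0 (by omega)
        have hi' : i = 3*d-2 ∨ i = 3*d-1 ∨ i = 3*d := by omega
        have hj' : j = 3*d-2 ∨ j = 3*d-1 ∨ j = 3*d := by omega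
        rcases hi' with rfl | rfl | rfl <;> rcases hj' with rfl | rfl | rfl
        exacts [rfl, absurd h₂ r₁, absurd h₂ r₂, absurd h₂.symm r₁, rfl, absurd h₂ r₃,
          absurd h₂.symm r₂, absurd h₂.symm r₃, rfl]
    · intro h
      obtain ⟨h₁, -⟩ := ZMod.digits_sub_eq (huv i hi).1 (huv i hi).2 (huv j hj).2 (huv j hj).1 h
      obtain ⟨rfl, rfl⟩ := htt.eq_zero_of_sub_eq_neg hi hj h₁
      have hz : x 0 - y 0 = 0 := by
        have hodd : ∀ n, n = 2 * (3*q+1) + 1 → ∀ z : ZMod n, z = -z → z = 0 := by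
          rintro _ rfl z hz
          exact ZMod.eq_zero_of_eq_neg hz
        exact hodd _ (by ring) _ (by rw [neg_sub]; exact h)
      obtain ⟨-, h₂⟩ := ZMod.digits_sub_eq (C := 0) (D := 0) (c := 0) (d := 0)
        (huv 0 hi).1 (huv 0 hi).2 (by omega) (by omega) (hz.trans (by simp))
      exact row0 (by simpa using h₂)
  have hcard : 2 * (3*q+1) + 1 = 3 * (2*q+1) := by ring
  refine ⟨entries, ?_, diffs, ?_, ?_, ?_⟩
  · exact ZMod.ne_zero_iff_exists_of_injective hcard x y entries fun i hi =>
      ⟨by simpa [hx] using entry_ne i hi false, by simpa [hy] using entry_ne i hi true⟩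
  · refine ZMod.ne_zero_iff_exists_of_injective hcard _ _ (fun i j hi hj =>
      ⟨(diffs i j hi hj).1, fun h => (diffs i j hi hj).1 ?_, (diffs i j hi hj).2⟩)
      fun i hi => ⟨fun h => (diffs i i hi hi).2 ?_, fun h => (diffs i i hi hi).2 ?_⟩
    · linear_combination -h
    · linear_combination 2 * h
    · linear_combination -2 * h
  · intro i j hi hj h
    by_contra hne
    obtain ⟨h₁, h₂⟩ := ZMod.digits_add_eq (huv i hi).1 (huv i hi).2 (huv j hj).1 (huv j hj).2 h
    exact sum1 i j hi hj hne h₁ h₂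
  · intro i hi h
    obtain ⟨h₁, h₂⟩ := ZMod.digits_add_eq (C := 0) (D := 0) (c := 0) (d := 0)
      (huv i hi).1 (huv i hi).2 (by omega) (by omega) (h.trans (by simp))
    exact sum0 i hi h₁ (by simpa using h₂)
end

section
/- Let m = 2q+1 ≥ 3 be odd and let T = [(x_1,y_1),…,(x_q,y_q)] be an ordered strong starter in ℤ/m, i.e. an ordered starter whose q sums x_i + y_i are pairwise distinct and all nonzero in ℤ/m. Then the set K(T) of admissible keys has exactly (m−1)/2 = q elements. -/
/-- An ordered starter of order `m = 2q+1`, presented as a family of pairs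
`(x i, y i)`, `i = 1,…,q`: the `2q` components are pairwise distinct and comprise
`ℤ/m ∖ {0}`, and `y i − x i = ±i` in `ℤ/m` for each `i`. -/
def IsOrderedStarter (q : ℕ) (x y : ℕ → ZMod (2*q+1)) : Prop :=
  (∀ i j, 1 ≤ i → i ≤ q → 1 ≤ j → j ≤ q →
    (x i = x j → i = j) ∧ (y i = y j → i = j) ∧ x i ≠ y j) ∧
  (∀ z : ZMod (2*q+1), z ≠ 0 ↔ ∃ i, 1 ≤ i ∧ i ≤ q ∧ (x i = z ∨ y i = z)) ∧
  (∀ i, 1 ≤ i → i ≤ q →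
    (y i - x i = (i : ZMod (2*q+1)) ∨ y i - x i = -(i : ZMod (2*q+1))))

/-- The triplication template `Σ⁰(T,t)` built from the ordered starter
`T = [(x i, y i)]` and the key `t`, as a family of `3q+1` ordered pairs:
index `0 ↦ (t,t)`, and for `i = 1,…,q`, index `3i−2 ↦ (x i, y i)`,
index `3i−1 ↦ (t + x i, t + y i)`, index `3i ↦ (t − y i, t − x i)`. -/
def tmpl (q : ℕ) (x y : ℕ → ZMod (2*q+1)) (t : ZMod (2*q+1)) (i : ℕ) :
    ZMod (2*q+1) × ZMod (2*q+1) :=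
  if i = 0 then (t, t)
  else if (i - 1) % 3 = 0 then (x ((i+2)/3), y ((i+2)/3))
  else if (i - 1) % 3 = 1 then (t + x ((i+2)/3), t + y ((i+2)/3))
  else (t - y ((i+2)/3), t - x ((i+2)/3))

/-- The key `t` is admissible for the ordered starter `T = [(x i, y i)]` if `t ≠ 0`
and no two of the `3q+1` ordered pairs of the template `Σ⁰(T,t)` are equal. -/
def IsAdmissibleKey (q : ℕ) (x y : ℕ → ZMod (2*q+1)) (t : ZMod (2*q+1)) : Prop :=
  t ≠ 0 ∧ ∀ i j, i < 3*q+1 → j < 3*q+1 → tmpl q x y t i = tmpl q x y t j → i = j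

/-- Two indices in `1,…,q` whose images in `ℤ/(2q+1)` agree up to sign are equal. -/
theorem eq_of_cast_eq_or_eq_neg {q a b : ℕ} (ha : 1 ≤ a) (haq : a ≤ q) (hbq : b ≤ q)
    (h : (a : ZMod (2*q+1)) = b ∨ (a : ZMod (2*q+1)) = -b) : a = b := by
  rcases h with h | h
  · rw [ZMod.natCast_eq_natCast_iff'] at h
    rwa [Nat.mod_eq_of_lt (by omega), Nat.mod_eq_of_lt (by omega)] at h
  · have h0 : ((a + b : ℕ) : ZMod (2*q+1)) = 0 := by
      push_cast
      rw [h, neg_add_cancel]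
    rw [ZMod.natCast_eq_zero_iff] at h0
    have := Nat.le_of_dvd (by omega) h0
    omega

/-- The signed differences of an ordered starter are pairwise distinct. -/
theorem IsOrderedStarter.eq_of_sub_eq {q : ℕ} {x y : ℕ → ZMod (2*q+1)}
    (hT : IsOrderedStarter q x y) {a b : ℕ} (ha : 1 ≤ a) (haq : a ≤ q) (hb : 1 ≤ b)
    (hbq : b ≤ q) (h : y a - x a = y b - x b) : a = b := by
  refine eq_of_cast_eq_or_eq_neg ha haq hbq ?_
  rcases hT.2.2 a ha haq with h1 | h1 <;> rcases hT.2.2 b hb hbq with h2 | h2 <;>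
    rw [h1, h2] at h
  · exact .inl h
  · exact .inr h
  · exact .inr (by rw [← h, neg_neg])
  · exact .inl (neg_injective h)

/-- The signed differences of an ordered starter are nonzero. -/
theorem IsOrderedStarter.sub_ne_zero {q : ℕ} {x y : ℕ → ZMod (2*q+1)}
    (hT : IsOrderedStarter q x y) {a : ℕ} (ha : 1 ≤ a) (haq : a ≤ q) : y a - x a ≠ 0 :=
  fun h => (hT.1 a a ha haq ha haq).2.2 (sub_eq_zero.mp h).symm

@[simp]
theorem tmpl_zero (q : ℕ) (x y : ℕ → ZMod (2*q+1)) (t : ZMod (2*q+1)) :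
    tmpl q x y t 0 = (t, t) := rfl

/-- A nonzero template index sits in the block of `(i+2)/3`, in one of three positions. -/
theorem tmpl_cases (q : ℕ) (x y : ℕ → ZMod (2*q+1)) (t : ZMod (2*q+1)) {i : ℕ} (hi : i ≠ 0) :
    ∃ a, 1 ≤ a ∧
      (i = 3*a-2 ∧ tmpl q x y t i = (x a, y a) ∨
       i = 3*a-1 ∧ tmpl q x y t i = (t + x a, t + y a) ∨
       i = 3*a ∧ tmpl q x y t i = (t - y a, t - x a)) := by
  refine ⟨(i+2)/3, by omega, ?_⟩
  by_cases h0 : (i - 1) % 3 = 0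
  · exact .inl ⟨by omega, by simp [tmpl, hi, h0]⟩
  by_cases h1 : (i - 1) % 3 = 1
  · exact .inr (.inl ⟨by omega, by simp [tmpl, hi, h1]⟩)
  · exact .inr (.inr ⟨by omega, by simp [tmpl, hi, h0, h1]⟩)

theorem tmpl_first (q : ℕ) (x y : ℕ → ZMod (2*q+1)) (t : ZMod (2*q+1)) {a : ℕ} (ha : 1 ≤ a) :
    tmpl q x y t (3*a-2) = (x a, y a) := by
  rw [tmpl, if_neg (by omega), if_pos (by omega), show (3*a-2+2)/3 = a by omega]

theorem tmpl_third (q : ℕ) (x y : ℕ → ZMod (2*q+1)) (t : ZMod (2*q+1)) {a : ℕ} (ha : 1 ≤ a) :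
    tmpl q x y t (3*a) = (t - y a, t - x a) := by
  rw [tmpl, if_neg (by omega), if_neg (by omega), if_neg (by omega),
    show (3*a+2)/3 = a by omega]

/-- For an ordered starter without vanishing pair sums, the admissible keys are the nonzero
elements that are not pair sums. -/
theorem IsOrderedStarter.isAdmissibleKey_iff {q : ℕ} {x y : ℕ → ZMod (2*q+1)}
    (hT : IsOrderedStarter q x y) (hsums0 : ∀ i, 1 ≤ i → i ≤ q → x i + y i ≠ 0)
    (t : ZMod (2*q+1)) :
    IsAdmissibleKey q x y t ↔ t ≠ 0 ∧ ∀ a, 1 ≤ a → a ≤ q → x a + y a ≠ t := by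
  refine and_congr_right fun ht => ⟨fun h a ha haq hs => ?_, fun h i j hi hj hij => ?_⟩
  · have := h (3*a-2) (3*a) (by omega) (by omega) (by
      rw [tmpl_first q x y t ha, tmpl_third q x y t ha, ← hs]
      simp)
    omega
  · have hdiff : (tmpl q x y t i).2 - (tmpl q x y t i).1
        = (tmpl q x y t j).2 - (tmpl q x y t j).1 := by rw [hij]
    rcases eq_or_ne i 0 with rfl | hi0 <;> rcases eq_or_ne j 0 with rfl | hj0
    · rfl
    · obtain ⟨b, hb, hb'⟩ := tmpl_cases q x y t hj0
      refine absurd ?_ (hT.sub_ne_zero hb (by omega))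
      rcases hb' with ⟨-, e⟩ | ⟨-, e⟩ | ⟨-, e⟩ <;> rw [e] at hdiff <;> simpa using hdiff.symm
    · obtain ⟨a, ha, ha'⟩ := tmpl_cases q x y t hi0
      refine absurd ?_ (hT.sub_ne_zero ha (by omega))
      rcases ha' with ⟨-, e⟩ | ⟨-, e⟩ | ⟨-, e⟩ <;> rw [e] at hdiff <;> simpa using hdiff
    · obtain ⟨a, ha, ha'⟩ := tmpl_cases q x y t hi0
      obtain ⟨b, hb, hb'⟩ := tmpl_cases q x y t hj0
      have hab : a = b := by
        refine hT.eq_of_sub_eq ha (by omega) hb (by omega) ?_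
        rcases ha' with ⟨-, e⟩ | ⟨-, e⟩ | ⟨-, e⟩ <;>
          rcases hb' with ⟨-, e'⟩ | ⟨-, e'⟩ | ⟨-, e'⟩ <;>
          rw [e, e'] at hdiff <;> simpa using hdiff
      subst hab
      have haq : a ≤ q := by omega
      have hs := h a ha haq
      have hs0 := hsums0 a ha haq
      rcases ha' with ⟨hi', e⟩ | ⟨hi', e⟩ | ⟨hi', e⟩ <;>
        rcases hb' with ⟨hj', e'⟩ | ⟨hj', e'⟩ | ⟨hj', e'⟩ <;>
        first
        | exact hi'.trans hj'.symm
        | (rw [e, e', Prod.mk.injEq] at hij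
           grind)

/-- for an ordered strong starter `T` of order `m = 2q+1` (pair sums
pairwise distinct and nonzero), the set of admissible keys has exactly
`(m−1)/2 = q` elements. -/
theorem stmt14 (q : ℕ) (hq : 1 ≤ q) (x y : ℕ → ZMod (2*q+1))
    (hT : IsOrderedStarter q x y)
    (hsums : ∀ i j, 1 ≤ i → i ≤ q → 1 ≤ j → j ≤ q → x i + y i = x j + y j → i = j)
    (hsums0 : ∀ i, 1 ≤ i → i ≤ q → x i + y i ≠ 0) :
    {t : ZMod (2*q+1) | IsAdmissibleKey q x y t}.ncard = q := by
  classical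
  have hset : {t : ZMod (2*q+1) | IsAdmissibleKey q x y t}
      = ((insert 0 ((Finset.Icc 1 q).image fun a => x a + y a))ᶜ : Finset (ZMod (2*q+1))) := by
    ext t
    simp [hT.isAdmissibleKey_iff hsums0 t, and_comm (a := ¬t = 0)]
  have hinj : Set.InjOn (fun a => x a + y a) (Finset.Icc 1 q : Finset ℕ) := by
    intro a ha b hb hab
    rw [Finset.mem_coe, Finset.mem_Icc] at ha hb
    exact hsums a b ha.1 ha.2 hb.1 hb.2 hab
  have h0 : (0 : ZMod (2*q+1)) ∉ (Finset.Icc 1 q).image fun a => x a + y a := by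
    simpa using hsums0
  rw [hset, Set.ncard_coe_finset, Finset.card_compl, ZMod.card,
    Finset.card_insert_of_notMem h0, Finset.card_image_of_injOn hinj, Nat.card_Icc]
  omega
end

section
/- Let m = 2q+1 ≥ 3 be odd and let μ be an integer with 2 ≤ μ ≤ m−2 such that both μ−1 and μ are coprime with m. For i = 1,…,q let x_i ∈ ℤ/m be the unique solution of (μ−1)·x_i = i, and set E(μ) = [(x_1, μ·x_1),…,(x_q, μ·x_q)] and E′(μ) = [(−μ·x_1, −x_1),…,(−μ·x_q, −x_q)]. Then E(μ) and E′(μ) are ordered pseudostarters in ℤ/m and they form a special pair: in the multiset union of all 4q components of E(μ) and E′(μ), every nonzero element of ℤ/m occurs exactly twice (and 0 does not occur). -/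
/-- A pseudostarter in `ℤ/m`, `m = 2q+1`: a list of `q` pairs `(a d, b d)`,
`d = 1,…,q`, such that the `2q` differences `±(b d − a d)` comprise `ℤ/m ∖ {0}`. -/
def IsPseudostarter (q : ℕ) (a b : ℕ → ZMod (2*q+1)) : Prop :=
  ∀ z : ZMod (2*q+1), z ≠ 0 ↔ ∃ d, 1 ≤ d ∧ d ≤ q ∧ (b d - a d = z ∨ a d - b d = z)

theorem natCast_eq_iff_eq_val {q i : ℕ} (hi : i ≤ q) (z : ZMod (2*q+1)) :
    (i : ZMod (2*q+1)) = z ↔ i = z.val := by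
  constructor
  · rintro rfl
    rw [ZMod.val_natCast_of_lt (by omega)]
  · rintro rfl
    exact ZMod.natCast_zmod_val z

theorem neg_natCast_eq_iff {q i : ℕ} (h1 : 1 ≤ i) (hi : i ≤ q) (z : ZMod (2*q+1)) :
    -(i : ZMod (2*q+1)) = z ↔ i = 2*q+1 - z.val := by
  have hz := ZMod.val_lt z
  have key : -(i : ZMod (2*q+1)) = z ↔ 2*q+1 ∣ i + z.val := by
    rw [← ZMod.natCast_eq_zero_iff, Nat.cast_add, ZMod.natCast_zmod_val, neg_eq_iff_add_eq_zero]
  rw [key]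
  constructor
  · rintro ⟨k, hk⟩
    have : k = 1 := by
      have h2 : k < 2 := by
        by_contra! h
        nlinarith
      have h0 : k ≠ 0 := by
        rintro rfl
        omega
      omega
    subst this
    omega
  · intro h
    exact ⟨1, by omega⟩

/-- Every nonzero residue mod `2q+1` is `±i` for exactly one `1 ≤ i ≤ q` and one sign. -/
theorem card_natCast_eq_add_card_neg_natCast_eq (q : ℕ) (z : ZMod (2*q+1)) :
    ((Finset.Icc 1 q).filter (fun i : ℕ => (i : ZMod (2*q+1)) = z)).card +
      ((Finset.Icc 1 q).filter (fun i : ℕ => -(i : ZMod (2*q+1)) = z)).card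
      = if z = 0 then 0 else 1 := by
  have e1 : (Finset.Icc 1 q).filter (fun i : ℕ => (i : ZMod (2*q+1)) = z)
      = (Finset.Icc 1 q).filter (fun i : ℕ => i = z.val) :=
    Finset.filter_congr fun i hi => natCast_eq_iff_eq_val (Finset.mem_Icc.1 hi).2 z
  have e2 : (Finset.Icc 1 q).filter (fun i : ℕ => -(i : ZMod (2*q+1)) = z)
      = (Finset.Icc 1 q).filter (fun i : ℕ => i = 2*q+1 - z.val) :=
    Finset.filter_congr fun i hi =>
      neg_natCast_eq_iff (Finset.mem_Icc.1 hi).1 (Finset.mem_Icc.1 hi).2 z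
  have hz := ZMod.val_lt z
  have h0 := ZMod.val_eq_zero z
  rw [e1, e2, Finset.filter_eq', Finset.filter_eq']
  simp only [Finset.mem_Icc, ← h0, apply_ite Finset.card, Finset.card_singleton,
    Finset.card_empty]
  split_ifs <;> omega

/-- The values `±y i`, where `v * y i = i` for a unit `v`, are the nonzero residues, once each. -/
theorem card_eq_add_card_neg_eq {q : ℕ} {v : ZMod (2*q+1)} (hv : IsUnit v)
    {y : ℕ → ZMod (2*q+1)} (hy : ∀ i, 1 ≤ i → i ≤ q → v * y i = (i : ZMod (2*q+1)))
    (c : ZMod (2*q+1)) :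
    ((Finset.Icc 1 q).filter (fun i => y i = c)).card +
      ((Finset.Icc 1 q).filter (fun i => -(y i) = c)).card = if c = 0 then 0 else 1 := by
  have h := card_natCast_eq_add_card_neg_natCast_eq q (v * c)
  simp only [hv.mul_right_eq_zero] at h
  rw [← h]
  congr 2 <;> refine Finset.filter_congr fun i hi => ?_ <;>
    rw [← hy i (Finset.mem_Icc.1 hi).1 (Finset.mem_Icc.1 hi).2]
  · exact hv.mul_right_inj.symm
  · rw [← mul_neg]
    exact hv.mul_right_inj.symm

theorem isPseudostarter_of_sub_eq {q : ℕ} {a b : ℕ → ZMod (2*q+1)}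
    (h : ∀ i, 1 ≤ i → i ≤ q → b i - a i = (i : ZMod (2*q+1))) : IsPseudostarter q a b := by
  intro z
  have hz := ZMod.val_lt z
  have h0 := ZMod.val_eq_zero z
  have key : ∀ d, 1 ≤ d → d ≤ q → ((b d - a d = z ∨ a d - b d = z) ↔
      (d = z.val ∨ d = 2*q+1 - z.val)) := by
    intro d h1 h2
    rw [← neg_sub (b d), h d h1 h2, natCast_eq_iff_eq_val h2, neg_natCast_eq_iff h1 h2]
  constructor
  · intro hne
    have hpos : z.val ≠ 0 := fun h' => hne (h0.1 h')
    by_cases hle : z.val ≤ q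
    · exact ⟨z.val, by omega, hle, (key _ (by omega) hle).2 (Or.inl rfl)⟩
    · exact ⟨2*q+1 - z.val, by omega, by omega, (key _ (by omega) (by omega)).2 (Or.inr rfl)⟩
  · rintro ⟨d, h1, h2, h3⟩ hz0
    have h4 := h0.2 hz0
    rcases (key d h1 h2).1 h3 with h5 | h5 <;> omega

/-- Proposition `prop:epi-pair` (a): if `μ−1` and `μ` are coprime with
`m = 2q+1` and `x i` solves `(μ−1)·x i = i`, then the epicycloidal pseudostarter
`E(μ) = [(x i, μ·x i)]` and its conjugate `E′(μ) = [(−μ·x i, −x i)]` are ordered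
pseudostarters forming a special pair: every nonzero element of `ℤ/m` occurs exactly
twice among their `4q` components (and `0` does not occur). -/
theorem stmt15 (q μ : ℕ) (hq : 1 ≤ q) (hμ2 : 2 ≤ μ) (hμm : μ ≤ 2*q-1)
    (hcop1 : Nat.Coprime (μ - 1) (2*q+1)) (hcop : Nat.Coprime μ (2*q+1))
    (x : ℕ → ZMod (2*q+1))
    (hx : ∀ i, 1 ≤ i → i ≤ q →
      ((μ : ZMod (2*q+1)) - 1) * x i = (i : ZMod (2*q+1))) :
    IsPseudostarter q (fun i => x i) (fun i => (μ : ZMod (2*q+1)) * x i) ∧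
    IsPseudostarter q (fun i => -((μ : ZMod (2*q+1)) * x i)) (fun i => -(x i)) ∧
    (∀ i, 1 ≤ i → i ≤ q →
      ((μ : ZMod (2*q+1)) * x i - x i = (i : ZMod (2*q+1)) ∨
       (μ : ZMod (2*q+1)) * x i - x i = -(i : ZMod (2*q+1)))) ∧
    (∀ i, 1 ≤ i → i ≤ q →
      (-(x i) - (-((μ : ZMod (2*q+1)) * x i)) = (i : ZMod (2*q+1)) ∨
       -(x i) - (-((μ : ZMod (2*q+1)) * x i)) = -(i : ZMod (2*q+1)))) ∧
    (∀ c : ZMod (2*q+1),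
      (((Finset.Icc 1 q) ×ˢ (Finset.univ : Finset (Fin 2 × Bool))).filter
        (fun p =>
          (if p.2.1 = (0 : Fin 2) then
            (if p.2.2 then (μ : ZMod (2*q+1)) * x p.1 else x p.1)
          else
            (if p.2.2 then -(x p.1) else -((μ : ZMod (2*q+1)) * x p.1))) = c)).card
        = if c = 0 then 0 else 2) := by
  have hdiff : ∀ i, 1 ≤ i → i ≤ q → (μ : ZMod (2*q+1)) * x i - x i = (i : ZMod (2*q+1)) :=
    fun i h1 h2 => by rw [← hx i h1 h2]; ring
  have hdiff' : ∀ i, 1 ≤ i → i ≤ q →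
      -(x i) - (-((μ : ZMod (2*q+1)) * x i)) = (i : ZMod (2*q+1)) :=
    fun i h1 h2 => by rw [← hx i h1 h2]; ring
  refine ⟨isPseudostarter_of_sub_eq hdiff, isPseudostarter_of_sub_eq hdiff',
    fun i h1 h2 => Or.inl (hdiff i h1 h2), fun i h1 h2 => Or.inl (hdiff' i h1 h2), fun c => ?_⟩
  have hu : IsUnit ((μ : ZMod (2*q+1)) - 1) := by
    have := (ZMod.isUnit_iff_coprime (μ - 1) (2*q+1)).2 hcop1
    rwa [Nat.cast_sub (by omega), Nat.cast_one] at this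
  obtain ⟨w, hw⟩ := (ZMod.isUnit_iff_coprime μ (2*q+1)).2 hcop
  have hx' : ∀ i, 1 ≤ i → i ≤ q → (((μ : ZMod (2*q+1)) - 1) * ↑w⁻¹) *
      ((μ : ZMod (2*q+1)) * x i) = (i : ZMod (2*q+1)) := by
    intro i h1 h2
    rw [← hx i h1 h2, mul_assoc, ← mul_assoc _ _ (x i), ← hw, Units.inv_mul, one_mul]
  have hcard := card_eq_add_card_neg_eq hu hx c
  have hcard' := card_eq_add_card_neg_eq (hu.mul w⁻¹.isUnit) hx' c
  rw [Finset.card_filter] at hcard hcard' ⊢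
  rw [Finset.card_filter] at hcard hcard'
  rw [Finset.sum_product]
  simp only [Fintype.sum_prod_type, Fin.sum_univ_two, Fintype.sum_bool, Finset.sum_add_distrib,
    if_true, one_ne_zero, if_false, Bool.false_eq_true]
  split_ifs at hcard hcard' ⊢ <;> omega
end
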